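/- arXiv:1503.09174 — 2 statements merged into one kernel-verified Lean document; each statement's English description precedes it below -/
import Mathlib

section
/- Let w be a weight sequence with w(0) = 1 and w(k) > 0 for some k ≥ 2, and let π be the associated probability measure on ℤ₊ (defined via ρ, Φ, Ψ, ν and ξ as in the context); assume π(0) < 1. For P a partition, let N_k(P) denote its number of blocks of size k and ζ(P) its total number of blocks. Then for every integer k ≥ 1, Σ_{P ∈ ℕℂ_n} (Ω^w(P)/Z^w_n)·(N_k(P)/ζ(P)) converges to π(k)/(1 − π(0)) as n → ∞ along admissible n; that is, under ℙ^w_n the size of a uniformly random block converges in distribution to the law π(·)/(1 − π(0)) on ℕ. -/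
open scoped Classical

/-- `P` is a set partition of `[n] = {1, …, n}`: its blocks are nonempty subsets of
`{1, …, n}` and every element of `{1, …, n}` lies in exactly one block. -/
def IsPartitionOf (n : ℕ) (P : Finset (Finset ℕ)) : Prop :=
  (∀ B ∈ P, B ⊆ Finset.Icc 1 n ∧ B.Nonempty) ∧
    ∀ x ∈ Finset.Icc 1 n, ∃! B, B ∈ P ∧ x ∈ B

/-- A partition is non-crossing when there are no `a < b < c < d` with `a, c` in one
block and `b, d` in another, distinct block. -/
def IsNonCrossing (P : Finset (Finset ℕ)) : Prop :=
  ∀ B ∈ P, ∀ B' ∈ P, B ≠ B' →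
    ∀ a b c d : ℕ, a < b → b < c → c < d →
      a ∈ B → c ∈ B → b ∈ B' → d ∈ B' → False

/-- The (finite) set of non-crossing partitions of `[n]`. -/
noncomputable def NCP (n : ℕ) : Finset (Finset (Finset ℕ)) :=
  (Finset.Icc 1 n).powerset.powerset.filter fun P => IsPartitionOf n P ∧ IsNonCrossing P

/-- The set of non-crossing partitions of `[n]` all of whose block sizes belong to `A`. -/
noncomputable def NCPA (A : Set ℕ) (n : ℕ) : Finset (Finset (Finset ℕ)) :=
  (NCP n).filter fun P => ∀ B ∈ P, B.card ∈ A

/-- The probability measure `π_A` on `ℤ₊` associated with `A` and `ξ = ξ_A`. -/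
noncomputable def piA (A : Set ℕ) (ξ : ℝ) (k : ℕ) : ℝ :=
  if k = 0 ∨ k ∈ A then ξ ^ k / (1 + ∑' i : A, ξ ^ (i : ℕ)) else 0

/-- The weight of a partition: product of `w(size of B)` over blocks `B`. -/
noncomputable def OmegaP (w : ℕ → ℝ) (P : Finset (Finset ℕ)) : ℝ :=
  ∏ B ∈ P, w B.card

/-- The partition function `Z^w_n` of simply generated non-crossing partitions. -/
noncomputable def Zw (w : ℕ → ℝ) (n : ℕ) : ℝ :=
  ∑ P ∈ NCP n, OmegaP w P

/-- `(limsup_k w(k)^{1/k})` as an extended nonnegative real; `ρ` is its inverse. -/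
noncomputable def wLimsup (w : ℕ → ℝ) : ENNReal :=
  Filter.limsup (fun k : ℕ => ENNReal.ofReal (w k ^ (1 / (k : ℝ)))) Filter.atTop

/-- `π` is the probability measure on `ℤ₊` associated with the weight sequence `w`,
defined via `ρ = (limsup w(k)^{1/k})⁻¹`, `Φ`, `Ψ`, `ν` and `ξ`:
if `ρ = 0` then `π = δ_0`; otherwise `π(k) = w(k) ξ^k / Φ(ξ)` where either
`Ψ(ξ) = 1` (case `ν ≥ 1`) or `ξ = ρ` and `Ψ(ρ) ≤ 1` (case `ν < 1`). -/
def PiSpec (w : ℕ → ℝ) (π : ℕ → ℝ) : Prop :=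
  (wLimsup w = ⊤ ∧ π 0 = 1 ∧ ∀ k : ℕ, 1 ≤ k → π k = 0) ∨
  (wLimsup w ≠ ⊤ ∧ ∃ ξ : ℝ, 0 < ξ ∧ ENNReal.ofReal ξ ≤ (wLimsup w)⁻¹ ∧
    (Summable fun k : ℕ => (k : ℝ) * w k * ξ ^ k) ∧
    (∀ k : ℕ, π k = w k * ξ ^ k / ∑' j : ℕ, w j * ξ ^ j) ∧
    (∑' k : ℕ, (k : ℝ) * w k * ξ ^ k = ∑' k : ℕ, w k * ξ ^ k ∨
      (ENNReal.ofReal ξ = (wLimsup w)⁻¹ ∧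
        ∑' k : ℕ, (k : ℝ) * w k * ξ ^ k ≤ ∑' k : ℕ, w k * ξ ^ k)))

/-- `B` and `B'` contain no pattern `a < b < c < d` with `a, c ∈ B` and `b, d ∈ B'`. -/
def NonCross (B B' : Finset ℕ) : Prop :=
  ∀ a b c d : ℕ, a < b → b < c → c < d → a ∈ B → c ∈ B → b ∈ B' → d ∈ B' → False

/-- `P` is a non-crossing partition of the finite set `S`. -/
def IsNCOn (S : Finset ℕ) (P : Finset (Finset ℕ)) : Prop :=
  (∀ B ∈ P, B ⊆ S ∧ B.Nonempty) ∧ (∀ x ∈ S, ∃ B ∈ P, x ∈ B) ∧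
    ∀ B ∈ P, ∀ B' ∈ P, B ≠ B' → Disjoint B B' ∧ NonCross B B'

/-- The finite set of non-crossing partitions of `S`. -/
noncomputable def ncOn (S : Finset ℕ) : Finset (Finset (Finset ℕ)) :=
  S.powerset.powerset.filter (IsNCOn S)

/-- `(L, R)` is a non-crossing partition of `[n]` split into the block `L` containing `n`
(empty if `n = 0`) and the remaining blocks `R`. -/
def IsMarked (n : ℕ) (x : Finset ℕ × Finset (Finset ℕ)) : Prop :=
  x.1 ⊆ Finset.Icc 1 n ∧ (0 < n → n ∈ x.1) ∧ IsNCOn (Finset.Icc 1 n \ x.1) x.2 ∧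
    ∀ B ∈ x.2, NonCross x.1 B ∧ NonCross B x.1

/-- The finite set of non-crossing partitions of `[n]` with the block of `n` separated. -/
noncomputable def ncMarked (n : ℕ) : Finset (Finset ℕ × Finset (Finset ℕ)) :=
  ((Finset.Icc 1 n).powerset ×ˢ (Finset.Icc 1 n).powerset.powerset).filter (IsMarked n)

/-- The partition function in which the block of `n` gets the weight of a block with `j`
additional elements. -/
noncomputable def markedZ (w : ℕ → ℝ) (j n : ℕ) : ℝ :=
  ∑ x ∈ ncMarked n, OmegaP w x.2 * w (x.1.card + j)

lemma mem_ncOn {S : Finset ℕ} {P : Finset (Finset ℕ)} : P ∈ ncOn S ↔ IsNCOn S P := by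
  simp only [ncOn, Finset.mem_filter, Finset.mem_powerset, and_iff_right_iff_imp]
  intro h B hB
  exact Finset.mem_powerset.2 (h.1 B hB).1

lemma mem_ncMarked {n : ℕ} {x : Finset ℕ × Finset (Finset ℕ)} :
    x ∈ ncMarked n ↔ IsMarked n x := by
  simp only [ncMarked, Finset.mem_filter, Finset.mem_product, Finset.mem_powerset,
    and_iff_right_iff_imp]
  intro h
  refine ⟨h.1, fun B hB => Finset.mem_powerset.2 ?_⟩
  exact ((h.2.2.1.1 B hB).1).trans Finset.sdiff_subset

lemma NCP_eq_ncOn (n : ℕ) : NCP n = ncOn (Finset.Icc 1 n) := by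
  ext P
  rw [mem_ncOn]
  simp only [NCP, Finset.mem_filter, Finset.mem_powerset]
  constructor
  · rintro ⟨-, h1, h2⟩
    refine ⟨h1.1, fun x hx => ?_, fun B hB B' hB' hne => ⟨?_, h2 B hB B' hB' hne⟩⟩
    · obtain ⟨B, hB, -⟩ := h1.2 x hx
      exact ⟨B, hB⟩
    · rw [Finset.disjoint_left]
      intro x hx hx'
      exact hne ((h1.2 x ((h1.1 B hB).1 hx)).unique ⟨hB, hx⟩ ⟨hB', hx'⟩)
  · intro h
    refine ⟨fun B hB => Finset.mem_powerset.2 (h.1 B hB).1, ⟨h.1, fun x hx => ?_⟩,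
      fun B hB B' hB' hne => (h.2.2 B hB B' hB' hne).2⟩
    obtain ⟨B, hB, hxB⟩ := h.2.1 x hx
    refine ⟨B, ⟨hB, hxB⟩, fun B' hB' => ?_⟩
    by_contra hne
    exact Finset.disjoint_left.1 (h.2.2 B' hB'.1 B hB hne).1 hB'.2 hxB

lemma nonCross_map (m : ℕ) (B B' : Finset ℕ) :
    NonCross (B.map (addRightEmbedding m)) (B'.map (addRightEmbedding m)) ↔ NonCross B B' := by
  constructor
  · intro h a b c d hab hbc hcd ha hc hb hd
    exact h (a + m) (b + m) (c + m) (d + m) (by omega) (by omega) (by omega)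
      (by simpa using ha) (by simpa using hc) (by simpa using hb) (by simpa using hd)
  · intro h a b c d hab hbc hcd ha hc hb hd
    simp only [Finset.mem_map, addRightEmbedding_apply] at ha hb hc hd
    obtain ⟨a, ha, rfl⟩ := ha
    obtain ⟨b, hb, rfl⟩ := hb
    obtain ⟨c, hc, rfl⟩ := hc
    obtain ⟨d, hd, rfl⟩ := hd
    exact h a b c d (by omega) (by omega) (by omega) ha hc hb hd

lemma isNCOn_map (m : ℕ) (S : Finset ℕ) (P : Finset (Finset ℕ)) :
    IsNCOn (S.map (addRightEmbedding m))
      (P.map (Finset.mapEmbedding (addRightEmbedding m)).toEmbedding) ↔ IsNCOn S P := by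
  simp only [IsNCOn, Finset.forall_mem_map, RelEmbedding.coe_toEmbedding,
    Finset.mapEmbedding_apply, Finset.map_subset_map, Finset.map_nonempty, ne_eq,
    Finset.map_inj, Finset.disjoint_map, nonCross_map]
  simp

lemma sum_ncOn_Icc (w : ℕ → ℝ) (m g : ℕ) :
    ∑ P ∈ ncOn (Finset.Icc (m + 1) (m + g)), OmegaP w P = Zw w g := by
  have hS : Finset.Icc (m + 1) (m + g) = (Finset.Icc 1 g).map (addRightEmbedding m) := by
    rw [Finset.map_add_right_Icc]
    congr 1 <;> omega
  rw [Zw, NCP_eq_ncOn, hS]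
  symm
  refine Finset.sum_bij
    (fun P _ => P.map (Finset.mapEmbedding (addRightEmbedding m)).toEmbedding) ?_ ?_ ?_ ?_
  · intro P hP
    rw [mem_ncOn] at hP ⊢
    exact (isNCOn_map _ _ _).2 hP
  · intro P _ Q _ h
    exact Finset.map_injective _ h
  · intro P hP
    rw [mem_ncOn] at hP
    obtain ⟨P', hP'⟩ : ∃ P' : Finset (Finset ℕ), P'.map
        (Finset.mapEmbedding (addRightEmbedding m)).toEmbedding = P := by
      refine ⟨(Finset.Icc 1 g).powerset.filter fun B => B.map (addRightEmbedding m) ∈ P, ?_⟩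
      ext B
      simp only [Finset.mem_map, Finset.mem_filter, Finset.mem_powerset,
        RelEmbedding.coe_toEmbedding, Finset.mapEmbedding_apply]
      constructor
      · rintro ⟨C, ⟨-, hC⟩, rfl⟩
        exact hC
      · intro hB
        obtain ⟨C, hC, rfl⟩ := Finset.subset_map_iff.1 (hP.1 B hB).1
        exact ⟨C, ⟨hC, hB⟩, rfl⟩
    refine ⟨P', mem_ncOn.2 ((isNCOn_map m _ _).1 ?_), hP'⟩
    rwa [hP']
  · intro P _
    simp [OmegaP, Finset.prod_map]

lemma ncMarked_zero : ncMarked 0 = {(∅, ∅)} := by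
  ext ⟨L, R⟩
  simp only [mem_ncMarked, IsMarked, IsNCOn, Finset.mem_singleton, Prod.mk.injEq]
  constructor
  · intro h
    refine ⟨by simpa using h.1, Finset.eq_empty_of_forall_notMem fun B hB => ?_⟩
    obtain ⟨x, hx⟩ := (h.2.2.1.1 B hB).2
    simpa using (h.2.2.1.1 B hB).1 hx
  · rintro ⟨rfl, rfl⟩
    simp

lemma Zw_eq_markedZ (w : ℕ → ℝ) (hw0 : w 0 = 1) (n : ℕ) : Zw w n = markedZ w 0 n := by
  rw [Zw, NCP_eq_ncOn, markedZ]
  symm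
  rcases Nat.eq_zero_or_pos n with rfl | hn
  · have h1 : ncOn (Finset.Icc 1 0) = {∅} := by
      ext P
      simp only [mem_ncOn, IsNCOn, Finset.mem_singleton]
      constructor
      · intro h
        refine Finset.eq_empty_of_forall_notMem fun B hB => ?_
        obtain ⟨x, hx⟩ := (h.1 B hB).2
        simpa using (h.1 B hB).1 hx
      · rintro rfl
        simp
    rw [h1, ncMarked_zero]
    simp [OmegaP, hw0]
  have hnot : ∀ x ∈ ncMarked n, x.1 ∉ x.2 := by
    intro x hx h
    have hx := mem_ncMarked.1 hx
    have := (hx.2.2.1.1 _ h).1 (hx.2.1 hn)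
    simp [hx.2.1 hn] at this
  refine Finset.sum_bij (fun x _ => insert x.1 x.2) ?_ ?_ ?_ ?_
  · rintro ⟨L, R⟩ hx
    rw [mem_ncMarked] at hx
    rw [mem_ncOn]
    obtain ⟨h1, h2, h3, h4⟩ := hx
    simp only at h1 h2 h3 h4
    have hd : ∀ B ∈ R, Disjoint L B := fun B hB =>
      Finset.disjoint_right.2 fun x hx => (Finset.mem_sdiff.1 ((h3.1 B hB).1 hx)).2
    refine ⟨?_, ?_, ?_⟩
    · intro B hB
      rcases Finset.mem_insert.1 hB with rfl | hB
      · exact ⟨h1, ⟨n, h2 hn⟩⟩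
      · exact ⟨(h3.1 B hB).1.trans Finset.sdiff_subset, (h3.1 B hB).2⟩
    · intro x hx
      by_cases hxL : x ∈ L
      · exact ⟨L, by simp, hxL⟩
      · obtain ⟨B, hB, hxB⟩ := h3.2.1 x (Finset.mem_sdiff.2 ⟨hx, hxL⟩)
        exact ⟨B, by simp [hB], hxB⟩
    · intro B hB B' hB' hne
      rcases Finset.mem_insert.1 hB with rfl | hB <;>
        rcases Finset.mem_insert.1 hB' with rfl | hB'
      · exact absurd rfl hne
      · exact ⟨hd _ hB', (h4 _ hB').1⟩
      · exact ⟨(hd _ hB).symm, (h4 _ hB).2⟩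
      · exact h3.2.2 B hB B' hB' hne
  · rintro ⟨L, R⟩ hx ⟨L', R'⟩ hx' h
    have hn1 := hnot _ hx
    have hn2 := hnot _ hx'
    rw [mem_ncMarked] at hx hx'
    simp only at h hn1 hn2
    have hL : L = L' := by
      have h1 : L ∈ insert L' R' := by rw [← h]; simp
      rcases Finset.mem_insert.1 h1 with h1 | h1
      · exact h1
      · have := (hx'.2.2.1.1 _ h1).1 (hx.2.1 hn)
        simp [hx'.2.1 hn] at this
    subst hL
    rw [← Finset.erase_insert hn1, ← Finset.erase_insert hn2, h]
  · intro P hP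
    rw [mem_ncOn] at hP
    obtain ⟨L, hL, hnL⟩ := hP.2.1 n (by simp; omega)
    refine ⟨(L, P.erase L), mem_ncMarked.2 ⟨(hP.1 L hL).1, fun _ => hnL, ⟨?_, ?_, ?_⟩, ?_⟩,
      Finset.insert_erase hL⟩
    · intro B hB
      obtain ⟨hne, hB⟩ := Finset.mem_erase.1 hB
      refine ⟨fun x hx => Finset.mem_sdiff.2 ⟨(hP.1 B hB).1 hx, ?_⟩, (hP.1 B hB).2⟩
      exact Finset.disjoint_left.1 (hP.2.2 B hB L hL hne).1 hx
    · intro x hx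
      obtain ⟨hx, hxL⟩ := Finset.mem_sdiff.1 hx
      obtain ⟨B, hB, hxB⟩ := hP.2.1 x hx
      refine ⟨B, Finset.mem_erase.2 ⟨?_, hB⟩, hxB⟩
      rintro rfl
      exact hxL hxB
    · intro B hB B' hB' hne
      exact hP.2.2 B (Finset.mem_of_mem_erase hB) B' (Finset.mem_of_mem_erase hB') hne
    · intro B hB
      obtain ⟨hne, hB⟩ := Finset.mem_erase.1 hB
      exact ⟨(hP.2.2 L hL B hB hne.symm).2, (hP.2.2 B hB L hL hne).2⟩
  · intro x hx
    simp only [OmegaP]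
    rw [Finset.prod_insert (hnot x hx), mul_comm, add_zero]

lemma markedZ_zero (w : ℕ → ℝ) (j : ℕ) : markedZ w j 0 = w j := by
  simp [markedZ, ncMarked_zero, OmegaP]

lemma IsMarked.sup_eq {m : ℕ} {x : Finset ℕ × Finset (Finset ℕ)} (h : IsMarked m x) :
    x.1.sup id = m := by
  apply le_antisymm
  · exact Finset.sup_le fun a ha => (Finset.mem_Icc.1 (h.1 ha)).2
  · rcases Nat.eq_zero_or_pos m with rfl | hm
    · exact Nat.zero_le _
    · exact Finset.le_sup (f := id) (h.2.1 hm)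

lemma IsMarked.append {m n : ℕ} (hmn : m ≤ n) {L : Finset ℕ} {R P : Finset (Finset ℕ)}
    (h : IsMarked m (L, R)) (hP : IsNCOn (Finset.Icc (m + 1) n) P) :
    IsMarked (n + 1) (insert (n + 1) L, R ∪ P) := by
  obtain ⟨h1, h2, h3, h4⟩ := h
  simp only at h1 h2 h3 h4
  have hL : ∀ a ∈ L, 1 ≤ a ∧ a ≤ m := fun a ha => Finset.mem_Icc.1 (h1 ha)
  have hR : ∀ B ∈ R, ∀ a ∈ B, (1 ≤ a ∧ a ≤ m) ∧ a ∉ L := fun B hB a ha => by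
    simpa using (h3.1 B hB).1 ha
  have hP' : ∀ B ∈ P, ∀ a ∈ B, m + 1 ≤ a ∧ a ≤ n := fun B hB a ha => by
    simpa using (hP.1 B hB).1 ha
  have hRP : ∀ B ∈ R, ∀ B' ∈ P,
      (Disjoint B B' ∧ NonCross B B') ∧ (Disjoint B' B ∧ NonCross B' B) := by
    intro B hB B' hB'
    have hd : Disjoint B B' := Finset.disjoint_left.2 fun a ha ha' => by
      have := hR B hB a ha
      have := hP' B' hB' a ha'
      omega
    refine ⟨⟨hd, fun a b c d hab hbc hcd ha hc hb hd => ?_⟩,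
      ⟨hd.symm, fun a b c d hab hbc hcd ha hc hb hd => ?_⟩⟩
    · have := hR B hB c hc
      have := hP' B' hB' b hb
      omega
    · have := hR B hB b hb
      have := hP' B' hB' a ha
      omega
  refine ⟨?_, fun _ => Finset.mem_insert_self _ _, ⟨?_, ?_, ?_⟩, ?_⟩
  · intro a ha
    rcases Finset.mem_insert.1 ha with rfl | ha
    · simp
    · have := hL a ha
      simp only [Finset.mem_Icc]
      omega
  · intro B hB
    rcases Finset.mem_union.1 hB with hB | hB
    · refine ⟨fun a ha => ?_, (h3.1 B hB).2⟩
      have := hR B hB a ha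
      simp only [Finset.mem_sdiff, Finset.mem_Icc, Finset.mem_insert, not_or]
      exact ⟨by omega, by omega, this.2⟩
    · refine ⟨fun a ha => ?_, (hP.1 B hB).2⟩
      have := hP' B hB a ha
      simp only [Finset.mem_sdiff, Finset.mem_Icc, Finset.mem_insert, not_or]
      refine ⟨by omega, by omega, fun haL => ?_⟩
      have := hL a haL
      omega
  · intro a ha
    simp only [Finset.mem_sdiff, Finset.mem_Icc, Finset.mem_insert, not_or] at ha
    rcases le_or_gt a m with ham | ham
    · obtain ⟨B, hB, haB⟩ := h3.2.1 a (by simp; exact ⟨by omega, ha.2.2⟩)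
      exact ⟨B, Finset.mem_union_left _ hB, haB⟩
    · obtain ⟨B, hB, haB⟩ := hP.2.1 a (by simp; omega)
      exact ⟨B, Finset.mem_union_right _ hB, haB⟩
  · intro B hB B' hB' hne
    rcases Finset.mem_union.1 hB with hB | hB <;>
      rcases Finset.mem_union.1 hB' with hB' | hB'
    · exact h3.2.2 B hB B' hB' hne
    · exact (hRP B hB B' hB').1
    · exact (hRP B' hB' B hB).2
    · exact hP.2.2 B hB B' hB' hne
  · intro B hB
    rcases Finset.mem_union.1 hB with hB | hB
    · have key := hR B hB
      constructor
      · intro a b c d hab hbc hcd ha hc hb hd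
        have hd' := key d hd
        have ha' : a ∈ L := (Finset.mem_insert.1 ha).resolve_left (by omega)
        have hc' : c ∈ L := (Finset.mem_insert.1 hc).resolve_left (by omega)
        exact (h4 B hB).1 a b c d hab hbc hcd ha' hc' hb hd
      · intro a b c d hab hbc hcd ha hc hb hd
        have hc' := key c hc
        have hb' : b ∈ L := (Finset.mem_insert.1 hb).resolve_left (by omega)
        have hm : m ∈ L := h2 (by omega)
        have hcm : c ≠ m := fun h => hc'.2 (h ▸ hm)
        exact (h4 B hB).2 a b c m hab hbc (by omega) ha hc hb' hm
    · have key := hP' B hB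
      constructor
      · intro a b c d hab hbc hcd ha hc hb hd
        have h5 := key d hd
        have h6 := key b hb
        have hc' : c ∈ L := (Finset.mem_insert.1 hc).resolve_left (by omega)
        have := hL c hc'
        omega
      · intro a b c d hab hbc hcd ha hc hb hd
        have h5 := key a ha
        have h6 := key c hc
        have hb' : b ∈ L := (Finset.mem_insert.1 hb).resolve_left (by omega)
        have := hL b hb'
        omega

lemma IsMarked.exists_append {n : ℕ} {L : Finset ℕ} {R : Finset (Finset ℕ)}
    (h : IsMarked (n + 1) (L, R)) :
    ∃ m ≤ n, ∃ L' R' P, IsMarked m (L', R') ∧ IsNCOn (Finset.Icc (m + 1) n) P ∧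
      insert (n + 1) L' = L ∧ R' ∪ P = R := by
  obtain ⟨h1, h2, h3, h4⟩ := h
  simp only at h1 h2 h3 h4
  have hnL := h2 (by omega)
  have hR : ∀ B ∈ R, ∀ a ∈ B, (1 ≤ a ∧ a ≤ n + 1) ∧ a ∉ L := fun B hB a ha => by
    simpa using (h3.1 B hB).1 ha
  obtain ⟨m, hm⟩ : ∃ m, m = (L.erase (n + 1)).sup id := ⟨_, rfl⟩
  have hle : ∀ a ∈ L, a ≠ n + 1 → 1 ≤ a ∧ a ≤ m := fun a ha hne =>
    ⟨(Finset.mem_Icc.1 (h1 ha)).1,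
      hm ▸ Finset.le_sup (f := id) (Finset.mem_erase.2 ⟨hne, ha⟩)⟩
  have hmn : m ≤ n := by
    rw [hm]
    refine Finset.sup_le fun a ha => ?_
    obtain ⟨hne, ha⟩ := Finset.mem_erase.1 ha
    have := (Finset.mem_Icc.1 (h1 ha)).2
    simp only [id]
    omega
  have hmL : 0 < m → m ∈ L := by
    intro hpos
    have hne : (L.erase (n + 1)).Nonempty := by
      rw [Finset.nonempty_iff_ne_empty]
      intro h0
      rw [h0] at hm
      simp at hm
      omega
    obtain ⟨a, ha, ha'⟩ := Finset.exists_mem_eq_sup _ hne id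
    rw [hm, ha']
    exact Finset.mem_of_mem_erase ha
  have hsplit : ∀ B ∈ R, B ⊆ Finset.Icc 1 m ∨ B ⊆ Finset.Icc (m + 1) n := by
    intro B hB
    by_contra hcon
    rw [not_or, Finset.not_subset, Finset.not_subset] at hcon
    obtain ⟨⟨b, hb, hb'⟩, ⟨a, ha, ha'⟩⟩ := hcon
    have h5 := hR B hB a ha
    have h6 := hR B hB b hb
    have h7 : a ≠ n + 1 := fun h => h5.2 (h ▸ hnL)
    have h8 : b ≠ n + 1 := fun h => h6.2 (h ▸ hnL)
    simp only [Finset.mem_Icc] at ha' hb'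
    have h9 := hmL (by omega)
    have h10 : a ≠ m := fun h => h5.2 (h ▸ h9)
    exact (h4 B hB).2 a m b (n + 1) (by omega) (by omega) (by omega) ha hb h9 hnL
  refine ⟨m, hmn, L.erase (n + 1), R.filter (· ⊆ Finset.Icc 1 m),
    R.filter (· ⊆ Finset.Icc (m + 1) n), ⟨?_, ?_, ⟨?_, ?_, ?_⟩, ?_⟩, ⟨?_, ?_, ?_⟩,
    Finset.insert_erase hnL, ?_⟩
  · intro a ha
    obtain ⟨hne, ha⟩ := Finset.mem_erase.1 ha
    exact Finset.mem_Icc.2 (hle a ha hne)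
  · intro hpos
    exact Finset.mem_erase.2 ⟨by omega, hmL hpos⟩
  · intro B hB
    obtain ⟨hB, hB'⟩ := Finset.mem_filter.1 hB
    refine ⟨fun a ha => Finset.mem_sdiff.2 ⟨hB' ha, fun haL => ?_⟩, (h3.1 B hB).2⟩
    exact (hR B hB a ha).2 (Finset.mem_of_mem_erase haL)
  · intro a ha
    simp only [Finset.mem_sdiff, Finset.mem_Icc, Finset.mem_erase, not_and] at ha
    obtain ⟨B, hB, haB⟩ := h3.2.1 a (by simp; exact ⟨by omega, ha.2 (by omega)⟩)
    refine ⟨B, Finset.mem_filter.2 ⟨hB, (hsplit B hB).resolve_right fun hc => ?_⟩, haB⟩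
    have := Finset.mem_Icc.1 (hc haB)
    omega
  · intro B hB B' hB' hne
    exact h3.2.2 B (Finset.mem_filter.1 hB).1 B' (Finset.mem_filter.1 hB').1 hne
  · intro B hB
    have := h4 B (Finset.mem_filter.1 hB).1
    exact ⟨fun a b c d hab hbc hcd ha hc hb hd => this.1 a b c d hab hbc hcd
        (Finset.mem_of_mem_erase ha) (Finset.mem_of_mem_erase hc) hb hd,
      fun a b c d hab hbc hcd ha hc hb hd => this.2 a b c d hab hbc hcd ha hc
        (Finset.mem_of_mem_erase hb) (Finset.mem_of_mem_erase hd)⟩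
  · intro B hB
    obtain ⟨hB, hB'⟩ := Finset.mem_filter.1 hB
    exact ⟨hB', (h3.1 B hB).2⟩
  · intro a ha
    simp only [Finset.mem_Icc] at ha
    obtain ⟨B, hB, haB⟩ := h3.2.1 a (by
      simp only [Finset.mem_sdiff, Finset.mem_Icc]
      refine ⟨by omega, fun haL => ?_⟩
      have := hle a haL (by omega)
      omega)
    refine ⟨B, Finset.mem_filter.2 ⟨hB, (hsplit B hB).resolve_left fun hc => ?_⟩, haB⟩
    have := Finset.mem_Icc.1 (hc haB)
    omega
  · intro B hB B' hB' hne
    exact h3.2.2 B (Finset.mem_filter.1 hB).1 B' (Finset.mem_filter.1 hB').1 hne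
  · rw [← Finset.filter_or]
    exact Finset.filter_true_of_mem hsplit

lemma IsMarked.disjoint_of_isNCOn {m n : ℕ} {x : Finset ℕ × Finset (Finset ℕ)}
    {P : Finset (Finset ℕ)} (h : IsMarked m x) (hP : IsNCOn (Finset.Icc (m + 1) n) P) :
    Disjoint x.2 P := by
  refine Finset.disjoint_left.2 fun B hB hB' => ?_
  obtain ⟨a, ha⟩ := (hP.1 B hB').2
  have h5 := (Finset.mem_sdiff.1 ((h.2.2.1.1 B hB).1 ha)).1
  have h6 := (hP.1 B hB').1 ha
  simp only [Finset.mem_Icc] at h5 h6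
  omega

lemma filter_subset_union {S T : Finset ℕ} {P Q : Finset (Finset ℕ)} (hST : Disjoint S T)
    (hP : ∀ B ∈ P, B ⊆ S ∧ B.Nonempty) (hQ : ∀ B ∈ Q, B ⊆ T ∧ B.Nonempty) :
    (P ∪ Q).filter (· ⊆ S) = P := by
  ext B
  simp only [Finset.mem_filter, Finset.mem_union]
  constructor
  · rintro ⟨hB | hB, hBS⟩
    · exact hB
    · obtain ⟨a, ha⟩ := (hQ B hB).2
      exact absurd ((hQ B hB).1 ha) (Finset.disjoint_left.1 hST (hBS ha))
  · exact fun hB => ⟨Or.inl hB, (hP B hB).1⟩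

lemma markedZ_succ (w : ℕ → ℝ) (j n : ℕ) :
    markedZ w j (n + 1) =
      ∑ m ∈ Finset.range (n + 1), Zw w (n - m) * markedZ w (j + 1) m := by
  have key : ∀ m ∈ Finset.range (n + 1), Zw w (n - m) * markedZ w (j + 1) m =
      ∑ y ∈ ncOn (Finset.Icc (m + 1) n) ×ˢ ncMarked m,
        OmegaP w y.1 * (OmegaP w y.2.2 * w (y.2.1.card + (j + 1))) := by
    intro m hm
    rw [Finset.sum_product, markedZ, ← sum_ncOn_Icc w m (n - m),
      Nat.add_sub_of_le (by simpa [Nat.lt_succ_iff] using hm), Finset.sum_mul_sum]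
  rw [Finset.sum_congr rfl key, Finset.sum_sigma', markedZ]
  symm
  refine Finset.sum_bij (fun y _ => (insert (n + 1) y.2.2.1, y.2.2.2 ∪ y.2.1)) ?_ ?_ ?_ ?_
  · rintro ⟨m, P, L, R⟩ hy
    simp only [Finset.mem_sigma, Finset.mem_range, Finset.mem_product, mem_ncOn,
      mem_ncMarked] at hy ⊢
    exact hy.2.2.append (by omega) hy.2.1
  · rintro ⟨m, P, L, R⟩ hy ⟨m', P', L', R'⟩ hy' heq
    simp only [Finset.mem_sigma, Finset.mem_range, Finset.mem_product, mem_ncOn,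
      mem_ncMarked] at hy hy'
    simp only [Prod.mk.injEq] at heq
    have hnot : ∀ {m L R}, m < n + 1 → IsMarked m (L, R) → n + 1 ∉ L := by
      intro m L R hm h hmem
      have := (Finset.mem_Icc.1 (h.1 hmem)).2
      omega
    have hL : L = L' := by
      rw [← Finset.erase_insert (hnot hy.1 hy.2.2), heq.1,
        Finset.erase_insert (hnot hy'.1 hy'.2.2)]
    subst hL
    have hm : m = m' := hy.2.2.sup_eq.symm.trans hy'.2.2.sup_eq
    subst hm
    have hd : Disjoint (Finset.Icc 1 m) (Finset.Icc (m + 1) n) :=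
      Finset.disjoint_left.2 fun a ha ha' => by
        simp only [Finset.mem_Icc] at ha ha'
        omega
    have hsub : ∀ {R : Finset (Finset ℕ)}, IsMarked m (L, R) →
        ∀ B ∈ R, B ⊆ Finset.Icc 1 m ∧ B.Nonempty := fun h B hB =>
      ⟨(h.2.2.1.1 B hB).1.trans Finset.sdiff_subset, (h.2.2.1.1 B hB).2⟩
    have hR : R = R' := by
      rw [← filter_subset_union hd (hsub hy.2.2) hy.2.1.1, heq.2,
        filter_subset_union hd (hsub hy'.2.2) hy'.2.1.1]
    have hP : P = P' := by
      rw [← filter_subset_union hd.symm hy.2.1.1 (hsub hy.2.2), Finset.union_comm, heq.2,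
        Finset.union_comm, filter_subset_union hd.symm hy'.2.1.1 (hsub hy'.2.2)]
    rw [hR, hP]
  · rintro ⟨L, R⟩ hx
    obtain ⟨m, hmn, L', R', P, h1, h2, h3, h4⟩ := (mem_ncMarked.1 hx).exists_append
    refine ⟨⟨m, P, L', R'⟩, ?_, by simp only [h3, h4]⟩
    simp only [Finset.mem_sigma, Finset.mem_range, Finset.mem_product, mem_ncOn, mem_ncMarked]
    exact ⟨by omega, h2, h1⟩
  · rintro ⟨m, P, L, R⟩ hy
    simp only [Finset.mem_sigma, Finset.mem_range, Finset.mem_product, mem_ncOn,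
      mem_ncMarked] at hy
    have hnot : n + 1 ∉ L := fun h => by
      have := (Finset.mem_Icc.1 (hy.2.2.1 h)).2
      omega
    simp only [OmegaP]
    rw [Finset.prod_union (hy.2.2.disjoint_of_isNCOn hy.2.1), Finset.card_insert_of_notMem hnot,
      show L.card + 1 + j = L.card + (j + 1) by ring]
    ring

lemma OmegaP_nonneg {w : ℕ → ℝ} (hw : ∀ i, 0 ≤ w i) (P : Finset (Finset ℕ)) :
    0 ≤ OmegaP w P :=
  Finset.prod_nonneg fun _ _ => hw _

lemma Zw_nonneg {w : ℕ → ℝ} (hw : ∀ i, 0 ≤ w i) (n : ℕ) : 0 ≤ Zw w n :=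
  Finset.sum_nonneg fun P _ => OmegaP_nonneg hw P

lemma markedZ_nonneg {w : ℕ → ℝ} (hw : ∀ i, 0 ≤ w i) (j n : ℕ) : 0 ≤ markedZ w j n :=
  Finset.sum_nonneg fun x _ => mul_nonneg (OmegaP_nonneg hw x.2) (hw _)

lemma Zw_zero {w : ℕ → ℝ} (hw0 : w 0 = 1) : Zw w 0 = 1 := by
  rw [Zw_eq_markedZ w hw0, markedZ_zero, hw0]

lemma markedZ_succ_mul_pow (w : ℕ → ℝ) (z : ℝ) (j n : ℕ) :
    markedZ w j (n + 1) * z ^ (n + 1) = z * ∑ m ∈ Finset.range (n + 1),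
      (markedZ w (j + 1) m * z ^ m) * (Zw w (n - m) * z ^ (n - m)) := by
  rw [markedZ_succ, Finset.sum_mul, Finset.mul_sum]
  refine Finset.sum_congr rfl fun m hm => ?_
  have hm : m ≤ n := by simpa [Nat.lt_succ_iff] using hm
  have : z ^ (n + 1) = z * (z ^ m * z ^ (n - m)) := by
    rw [← pow_add, Nat.add_sub_of_le hm, pow_succ, mul_comm]
  rw [this]
  ring

lemma sum_markedZ_le {w : ℕ → ℝ} (hw : ∀ i, 0 ≤ w i) (hw0 : w 0 = 1) {r c : ℝ} (hr : 0 < r)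
    (hc : HasSum (fun k => w k * r ^ k) c) (hcpos : 0 < c) (N : ℕ) :
    ∀ j, ∑ n ∈ Finset.range N, markedZ w j n * (r / c) ^ n ≤ ∑' k, w (k + j) * r ^ k := by
  have hz : 0 ≤ r / c := by positivity
  have hsum : ∀ j, Summable fun k => w (k + j) * r ^ k := by
    intro j
    have h := ((summable_nat_add_iff j).2 hc.summable).mul_right (r ^ j)⁻¹
    refine h.congr fun k => ?_
    rw [pow_add]
    field_simp
  induction N with
  | zero =>
    intro j
    simpa using tsum_nonneg fun k => mul_nonneg (hw _) (by positivity)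
  | succ N ih =>
    intro j
    have hZ : ∑ n ∈ Finset.range N, Zw w n * (r / c) ^ n ≤ c := by
      simpa [Zw_eq_markedZ w hw0, hc.tsum_eq] using ih 0
    have hnn : ∀ m, 0 ≤ markedZ w (j + 1) m * (r / c) ^ m := fun m =>
      mul_nonneg (markedZ_nonneg hw _ _) (by positivity)
    rw [Finset.sum_range_succ', (hsum j).tsum_eq_zero_add]
    simp only [markedZ_succ_mul_pow, markedZ_zero, pow_zero, mul_one, zero_add]
    rw [← Finset.mul_sum, Finset.sum_range_diag_flip N
      (fun m k => (markedZ w (j + 1) m * (r / c) ^ m) * (Zw w k * (r / c) ^ k)), add_comm]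
    refine add_le_add le_rfl ?_
    calc r / c * ∑ m ∈ Finset.range N, ∑ k ∈ Finset.range (N - m),
            markedZ w (j + 1) m * (r / c) ^ m * (Zw w k * (r / c) ^ k)
        ≤ r / c * ∑ m ∈ Finset.range N, markedZ w (j + 1) m * (r / c) ^ m * c := by
          gcongr with m hm
          rw [← Finset.mul_sum]
          refine mul_le_mul_of_nonneg_left (le_trans ?_ hZ) (hnn m)
          refine Finset.sum_le_sum_of_subset_of_nonneg ?_ fun k _ _ =>
            mul_nonneg (Zw_nonneg hw k) (by positivity)
          intro k hk
          simp only [Finset.mem_range] at hk ⊢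
          omega
      _ = r * ∑ m ∈ Finset.range N, markedZ w (j + 1) m * (r / c) ^ m := by
          rw [← Finset.sum_mul]
          field_simp
      _ ≤ r * ∑' k, w (k + (j + 1)) * r ^ k := by
          gcongr
          exact ih (j + 1)
      _ = ∑' k, w (k + 1 + j) * r ^ (k + 1) := by
          rw [← tsum_mul_left]
          refine tsum_congr fun k => ?_
          rw [show k + (j + 1) = k + 1 + j by ring]
          ring

lemma Zw_le {w : ℕ → ℝ} (hw : ∀ i, 0 ≤ w i) (hw0 : w 0 = 1) {r c : ℝ} (hr : 0 < r)
    (hc : HasSum (fun k => w k * r ^ k) c) (hcpos : 0 < c) (n : ℕ) :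
    Zw w n ≤ c * (c / r) ^ n := by
  have h := sum_markedZ_le hw hw0 hr hc hcpos (n + 1) 0
  simp only [add_zero, hc.tsum_eq] at h
  have h1 : markedZ w 0 n * (r / c) ^ n ≤ c := le_trans
    (Finset.single_le_sum (f := fun n => markedZ w 0 n * (r / c) ^ n)
      (fun i _ => mul_nonneg (markedZ_nonneg hw 0 i) (by positivity)) (by simp)) h
  rw [← Zw_eq_markedZ w hw0] at h1
  rw [← inv_div r c, inv_pow, ← div_eq_mul_inv, le_div_iff₀ (by positivity)]
  exact h1

lemma summable_tsum_le_of_summable_Zw {w : ℕ → ℝ} (hw : ∀ i, 0 ≤ w i) (hw0 : w 0 = 1) {z : ℝ}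
    (hz : 0 < z) (hs : Summable fun n => Zw w n * z ^ n) :
    (Summable fun k => w k * (z * ∑' n, Zw w n * z ^ n) ^ k) ∧
      ∑' k, w k * (z * ∑' n, Zw w n * z ^ n) ^ k ≤ ∑' n, Zw w n * z ^ n := by
  have hnn : ∀ j m, 0 ≤ markedZ w j m * z ^ m := fun j m =>
    mul_nonneg (markedZ_nonneg hw _ _) (by positivity)
  have hZnn : ∀ m, 0 ≤ Zw w m * z ^ m := fun m =>
    mul_nonneg (Zw_nonneg hw _) (by positivity)
  have hle : ∀ j m, markedZ w (j + 1) m ≤ markedZ w j (m + 1) := by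
    intro j m
    rw [markedZ_succ, Finset.sum_range_succ, Nat.sub_self, Zw_zero hw0, one_mul]
    exact le_add_of_nonneg_left (Finset.sum_nonneg fun i _ =>
      mul_nonneg (Zw_nonneg hw _) (markedZ_nonneg hw _ _))
  have hsum : ∀ j, Summable fun n => markedZ w j n * z ^ n := by
    intro j
    induction j with
    | zero => simpa only [Zw_eq_markedZ w hw0] using hs
    | succ j ih =>
      have h := ((summable_nat_add_iff 1).2 ih).mul_right z⁻¹
      refine Summable.of_nonneg_of_le (hnn _) (fun m => ?_) h
      rw [pow_succ, ← mul_assoc, mul_inv_cancel_right₀ hz.ne']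
      exact mul_le_mul_of_nonneg_right (hle j m) (by positivity)
  set T := z * ∑' n, Zw w n * z ^ n with hT
  have hTnn : 0 ≤ T := mul_nonneg hz.le (tsum_nonneg hZnn)
  have hrec : ∀ j, ∑' n, markedZ w j n * z ^ n =
      w j + T * ∑' n, markedZ w (j + 1) n * z ^ n := by
    intro j
    rw [(hsum j).tsum_eq_zero_add]
    simp only [markedZ_succ_mul_pow, markedZ_zero, pow_zero, mul_one]
    rw [tsum_mul_left, ← tsum_mul_tsum_eq_tsum_sum_range_of_summable_norm
      (f := fun m => markedZ w (j + 1) m * z ^ m) (g := fun m => Zw w m * z ^ m)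
      (hsum (j + 1)).norm hs.norm, hT]
    ring
  have hpart : ∀ K, ∑' n, Zw w n * z ^ n =
      ∑ k ∈ Finset.range K, w k * T ^ k + T ^ K * ∑' n, markedZ w K n * z ^ n := by
    intro K
    induction K with
    | zero => simp [Zw_eq_markedZ w hw0]
    | succ K ih =>
      rw [ih, hrec K, Finset.sum_range_succ]
      ring
  have hbound : ∀ K, ∑ k ∈ Finset.range K, w k * T ^ k ≤ ∑' n, Zw w n * z ^ n := by
    intro K
    rw [hpart K]
    exact le_add_of_nonneg_right (mul_nonneg (by positivity) (tsum_nonneg (hnn K)))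
  have htnn : ∀ k, 0 ≤ w k * T ^ k := fun k => mul_nonneg (hw k) (by positivity)
  exact ⟨summable_of_sum_range_le htnn hbound, Real.tsum_le_of_sum_range_le htnn hbound⟩

lemma Zw_mul_le {w : ℕ → ℝ} (hw : ∀ i, 0 ≤ w i) (hw0 : w 0 = 1) (m : ℕ) (n : ℕ) :
    Zw w n * Zw w m ≤ Zw w (n + m) := by
  induction n using Nat.strong_induction_on with
  | _ n ih =>
    rcases n with _ | n
    · simp [Zw_zero hw0]
    rw [Zw_eq_markedZ w hw0 (n + 1), show n + 1 + m = n + m + 1 by ring,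
      Zw_eq_markedZ w hw0 (n + m + 1), markedZ_succ, markedZ_succ, Finset.sum_mul]
    have hsub : Finset.range (n + 1) ⊆ Finset.range (n + m + 1) :=
      Finset.range_subset_range.2 (by omega)
    refine le_trans (Finset.sum_le_sum fun i hi => ?_)
      (Finset.sum_le_sum_of_subset_of_nonneg hsub fun i _ _ =>
        mul_nonneg (Zw_nonneg hw _) (markedZ_nonneg hw _ _))
    have hi : i < n + 1 := Finset.mem_range.1 hi
    have h := ih (n - i) (by omega)
    rw [show n - i + m = n + m - i by omega] at h
    calc Zw w (n - i) * markedZ w 1 i * Zw w m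
        = Zw w (n - i) * Zw w m * markedZ w 1 i := by ring
      _ ≤ _ := mul_le_mul_of_nonneg_right h (markedZ_nonneg hw _ _)

lemma Zw_mul_pow_le {w : ℕ → ℝ} (hw : ∀ i, 0 ≤ w i) (hw0 : w 0 = 1) (n p q : ℕ) :
    Zw w n * Zw w p ^ q ≤ Zw w (n + q * p) := by
  induction q with
  | zero => simp
  | succ q ih =>
    calc Zw w n * Zw w p ^ (q + 1) = Zw w n * Zw w p ^ q * Zw w p := by ring
      _ ≤ Zw w (n + q * p) * Zw w p := mul_le_mul_of_nonneg_right ih (Zw_nonneg hw p)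
      _ ≤ _ := by
        rw [show n + (q + 1) * p = n + q * p + p by ring]
        exact Zw_mul_le hw hw0 p (n + q * p)

lemma exists_pow_le_Zw {w : ℕ → ℝ} (hw : ∀ i, 0 ≤ w i) (hw0 : w 0 = 1) {lam : ℝ}
    (hlam : ∀ T, 0 < T → (Summable fun k => w k * T ^ k) → lam * T ≤ ∑' k, w k * T ^ k)
    {μ : ℝ} (hμ : 0 < μ) (hμl : μ < lam) : ∃ p, 0 < p ∧ μ ^ p ≤ Zw w p := by
  by_contra! hcon
  obtain ⟨y, hμy, hyl⟩ := exists_between hμl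
  have hy : 0 < y := hμ.trans hμy
  have hle : ∀ n, Zw w n ≤ μ ^ n := by
    intro n
    rcases Nat.eq_zero_or_pos n with rfl | hn
    · simp [Zw_zero hw0]
    · exact (hcon n hn).le
  have hs : Summable fun n => Zw w n * (1 / y) ^ n := by
    refine Summable.of_nonneg_of_le (fun n => mul_nonneg (Zw_nonneg hw n) (by positivity))
      (fun n => ?_) (summable_geometric_of_lt_one (r := μ / y) (by positivity)
        ((div_lt_one hy).2 hμy))
    calc Zw w n * (1 / y) ^ n ≤ μ ^ n * (1 / y) ^ n :=
          mul_le_mul_of_nonneg_right (hle n) (by positivity)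
      _ = (μ / y) ^ n := by rw [← mul_pow, mul_one_div]
  obtain ⟨h1, h2⟩ := summable_tsum_le_of_summable_Zw hw hw0 (by positivity) hs
  have hG : 0 < ∑' n, Zw w n * (1 / y) ^ n :=
    hs.tsum_pos (fun n => mul_nonneg (Zw_nonneg hw n) (by positivity)) 0 (by simp [Zw_zero hw0])
  set G := ∑' n, Zw w n * (1 / y) ^ n
  have h3 := (hlam (1 / y * G) (by positivity) h1).trans h2
  rw [← mul_assoc, mul_one_div] at h3
  have : 1 < lam / y := (one_lt_div hy).2 hyl
  nlinarith

lemma exists_mul_pow_le_Zw {w : ℕ → ℝ} (hw : ∀ i, 0 ≤ w i) (hw0 : w 0 = 1) {μ : ℝ}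
    (hμ : 0 < μ) {p : ℕ} (hp : 0 < p) (hpμ : μ ^ p ≤ Zw w p) :
    ∃ C > 0, ∀ n, 0 < Zw w n → C * μ ^ n ≤ Zw w n := by
  have hres : ∀ r : ℕ, ∃ C > 0, ∀ n, n % p = r → 0 < Zw w n → C * μ ^ n ≤ Zw w n := by
    intro r
    by_cases h : ∃ n, n % p = r ∧ 0 < Zw w n
    · obtain ⟨hr, hpos⟩ := Nat.find_spec h
      have hmin := fun n hn => Nat.find_min' h (m := n) hn
      set n₀ := Nat.find h
      refine ⟨Zw w n₀ / μ ^ n₀, by positivity, fun n hn hZ => ?_⟩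
      have hle := hmin n ⟨hn, hZ⟩
      obtain ⟨q, hq⟩ := (Nat.modEq_iff_dvd' hle).1 (hr.trans hn.symm)
      have hnq : n = n₀ + q * p := by
        rw [mul_comm]
        omega
      calc Zw w n₀ / μ ^ n₀ * μ ^ n = Zw w n₀ * (μ ^ p) ^ q := by
            rw [hnq, pow_add, mul_comm q p, pow_mul]
            field_simp
        _ ≤ Zw w n₀ * Zw w p ^ q := by gcongr
        _ ≤ Zw w n := hnq ▸ Zw_mul_pow_le hw hw0 n₀ p q
    · push Not at h
      exact ⟨1, one_pos, fun n hn hZ => absurd (h n hn) (not_le.2 hZ)⟩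
  choose C hC hCle using hres
  obtain ⟨r₀, -, hr₀⟩ := Finset.exists_min_image (Finset.range p) C ⟨0, by simpa using hp⟩
  refine ⟨C r₀, hC r₀, fun n hn => le_trans ?_ (hCle (n % p) n rfl hn)⟩
  exact mul_le_mul_of_nonneg_right (hr₀ _ (Finset.mem_range.2 (Nat.mod_lt _ hp)))
    (by positivity)

lemma le_of_summable_of_wLimsup {w : ℕ → ℝ} (hw : ∀ i, 0 ≤ w i) {T ξ : ℝ} (hT : 0 < T)
    (hξ : 0 < ξ) (hξw : ENNReal.ofReal ξ = (wLimsup w)⁻¹) (hs : Summable fun k => w k * T ^ k) :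
    T ≤ ξ := by
  have hev : ∀ᶠ k : ℕ in Filter.atTop,
      ENNReal.ofReal (w k ^ (1 / (k : ℝ))) ≤ ENNReal.ofReal T⁻¹ := by
    have h1 := hs.tendsto_atTop_zero.eventually (eventually_le_nhds zero_lt_one)
    filter_upwards [h1, Filter.eventually_gt_atTop 0] with k hk hk0
    refine ENNReal.ofReal_le_ofReal ?_
    have h2 : w k ≤ T⁻¹ ^ k := by
      rw [inv_pow, ← one_div, le_div_iff₀ (by positivity)]
      exact hk
    calc w k ^ (1 / (k : ℝ)) ≤ (T⁻¹ ^ k) ^ (1 / (k : ℝ)) :=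
          Real.rpow_le_rpow (hw k) h2 (by positivity)
      _ = T⁻¹ := by
          rw [one_div]
          exact Real.pow_rpow_inv_natCast (by positivity) hk0.ne'
  have hlim : wLimsup w ≤ ENNReal.ofReal T⁻¹ := Filter.limsup_le_of_le (by isBoundedDefault) hev
  rw [ENNReal.ofReal_inv_of_pos hT] at hlim
  have h3 : ENNReal.ofReal T ≤ ENNReal.ofReal ξ := by
    rw [hξw]
    exact ENNReal.le_inv_iff_le_inv.1 hlim
  exact (ENNReal.ofReal_le_ofReal_iff hξ.le).1 h3

lemma div_mul_le_tsum {w : ℕ → ℝ} (hw : ∀ i, 0 ≤ w i) {ξ c M : ℝ} (hξ : 0 < ξ)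
    (hc : HasSum (fun k => w k * ξ ^ k) c) (hM : HasSum (fun k : ℕ => (k : ℝ) * w k * ξ ^ k) M)
    (hcase : M = c ∨ (ENNReal.ofReal ξ = (wLimsup w)⁻¹ ∧ M ≤ c)) {T : ℝ} (hT : 0 < T)
    (hs : Summable fun k => w k * T ^ k) : c / ξ * T ≤ ∑' k, w k * T ^ k := by
  have hterm : ∀ k : ℕ, w k * ξ ^ k + (T / ξ - 1) * ((k : ℝ) * w k * ξ ^ k) ≤ w k * T ^ k := by
    intro k
    have hpos : 0 < T / ξ := by positivity
    have h := one_add_mul_le_pow (a := T / ξ - 1) (by linarith) k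
    rw [add_sub_cancel, div_pow, le_div_iff₀ (by positivity)] at h
    nlinarith [mul_le_mul_of_nonneg_left h (hw k)]
  have hle : c + (T / ξ - 1) * M ≤ ∑' k, w k * T ^ k :=
    hasSum_le hterm (hc.add (hM.mul_left _)) hs.hasSum
  refine le_trans ?_ hle
  rw [div_mul_eq_mul_div, mul_div_assoc]
  rcases hcase with rfl | ⟨hξw, hMc⟩
  · exact le_of_eq (by ring)
  · have h1 : T / ξ ≤ 1 := (div_le_one hξ).2 (le_of_summable_of_wLimsup hw hT hξ hξw hs)
    nlinarith

lemma exists_pos_lt_of_hasDerivAt_neg {f : ℝ → ℝ} {d : ℝ} (hf : HasDerivAt f d 0) (hd : d < 0) :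
    ∃ θ > 0, f θ < f 0 := by
  have h1 := (hasDerivAt_iff_tendsto_slope.1 hf).eventually (gt_mem_nhds hd)
  have h2 : ∀ᶠ θ in nhdsWithin (0 : ℝ) (Set.Ioi 0), slope f 0 θ < 0 :=
    h1.filter_mono (nhdsWithin_mono _ fun θ hθ => ne_of_gt hθ)
  obtain ⟨θ, hθ, hpos⟩ := (h2.and self_mem_nhdsWithin).exists
  have hpos : 0 < θ := hpos
  refine ⟨θ, hpos, ?_⟩
  rw [slope_def_field, sub_zero, div_lt_iff₀ hpos, zero_mul] at hθ
  linarith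

/-- Linear score of a block of size `j`; its sum over the blocks of a partition is nonnegative
when the proportion of blocks of size `k` deviates from `q` by at least `ε` in direction `σ`. -/
noncomputable def blockScore (k : ℕ) (σ q ε : ℝ) (j : ℕ) : ℝ :=
  if j = 0 then 0 else σ * ((if j = k then 1 else 0) - q) - ε

lemma sum_blockScore {n : ℕ} {P : Finset (Finset ℕ)} (hP : P ∈ NCP n) (k : ℕ) (σ q ε : ℝ) :
    ∑ B ∈ P, blockScore k σ q ε B.card =
      σ * (((P.filter fun B => B.card = k).card : ℝ) - q * P.card) - ε * P.card := by
  rw [NCP_eq_ncOn, mem_ncOn] at hP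
  have h : ∀ B ∈ P, blockScore k σ q ε B.card =
      σ * ((if B.card = k then 1 else 0) - q) - ε := fun B hB =>
    if_neg (Finset.card_pos.2 (hP.1 B hB).2).ne'
  rw [Finset.sum_congr rfl h, Finset.sum_sub_distrib, ← Finset.mul_sum, Finset.sum_sub_distrib,
    Finset.sum_boole]
  simp only [Finset.sum_const, nsmul_eq_mul]
  ring

lemma OmegaP_mul_exp (w a : ℕ → ℝ) (θ : ℝ) (P : Finset (Finset ℕ)) :
    OmegaP (fun j => w j * Real.exp (θ * a j)) P =
      OmegaP w P * Real.exp (θ * ∑ B ∈ P, a B.card) := by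
  simp only [OmegaP, Finset.prod_mul_distrib, Finset.mul_sum, Real.exp_sum]

lemma hasSum_tilt {w : ℕ → ℝ} (hw0 : w 0 = 1) {ξ c : ℝ}
    (hc : HasSum (fun k => w k * ξ ^ k) c) {k : ℕ} (hk : 1 ≤ k) (σ q ε θ : ℝ) :
    HasSum (fun j => w j * Real.exp (θ * blockScore k σ q ε j) * ξ ^ j)
      (c * Real.exp (θ * (-σ * q - ε)) + (1 - Real.exp (θ * (-σ * q - ε))) +
        w k * ξ ^ k * (Real.exp (θ * (σ * (1 - q) - ε)) - Real.exp (θ * (-σ * q - ε)))) := by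
  have h := ((hc.mul_right (Real.exp (θ * (-σ * q - ε)))).add
    (hasSum_ite_eq 0 (1 - Real.exp (θ * (-σ * q - ε))))).add
    (hasSum_ite_eq k (w k * ξ ^ k *
      (Real.exp (θ * (σ * (1 - q) - ε)) - Real.exp (θ * (-σ * q - ε)))))
  refine h.congr_fun ?_
  intro j
  by_cases hj : j = 0
  · subst hj
    have hk' : (0 : ℕ) ≠ k := by omega
    simp [blockScore, hw0, hk']
  · by_cases hjk : j = k
    · subst hjk
      simp only [blockScore, hj, if_true, if_false]
      ring
    · simp only [blockScore, hj, hjk, if_false]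
      rw [show σ * (0 - q) - ε = -σ * q - ε by ring]
      ring

lemma exists_tilt {w : ℕ → ℝ} (hw : ∀ i, 0 ≤ w i) (hw0 : w 0 = 1) {ξ c : ℝ} (hξ : 0 < ξ)
    (hc : HasSum (fun k => w k * ξ ^ k) c) (hc1 : 1 < c) {k : ℕ} (hk : 1 ≤ k) (σ : ℝ) {q ε : ℝ}
    (hq : q * (c - 1) = w k * ξ ^ k) (hε : 0 < ε) :
    ∃ θ > 0, ∃ c' > 0, c' < c ∧ ∀ n,
      ∑ P ∈ NCP n, OmegaP w P * Real.exp (θ * ∑ B ∈ P, blockScore k σ q ε B.card) ≤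
        c' * (c' / ξ) ^ n := by
  have hexp : ∀ a : ℝ, HasDerivAt (fun θ : ℝ => Real.exp (θ * a)) a 0 := fun a => by
    simpa using ((hasDerivAt_id (0 : ℝ)).mul_const a).exp
  have hder := (((hexp (-σ * q - ε)).const_mul c).add ((hexp (-σ * q - ε)).const_sub 1)).add
    (((hexp (σ * (1 - q) - ε)).sub (hexp (-σ * q - ε))).const_mul (w k * ξ ^ k))
  obtain ⟨θ, hθ, hlt⟩ := exists_pos_lt_of_hasDerivAt_neg hder (by
    rw [← hq]
    nlinarith)
  have hsum := hasSum_tilt hw0 hc hk σ q ε θ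
  have hw' : ∀ j, 0 ≤ w j * Real.exp (θ * blockScore k σ q ε j) := fun j =>
    mul_nonneg (hw j) (Real.exp_pos _).le
  have hw0' : w 0 * Real.exp (θ * blockScore k σ q ε 0) = 1 := by simp [blockScore, hw0]
  have hpos := hsum.tsum_eq ▸ hsum.summable.tsum_pos
    (fun j => mul_nonneg (hw' j) (by positivity)) 0 (by simp [hw0'])
  refine ⟨θ, hθ, _, hpos, by simpa using hlt, fun n => ?_⟩
  simpa only [Zw, OmegaP_mul_exp] using Zw_le hw' hw0' hξ hsum hpos n

lemma exists_tilt_tendsto {w : ℕ → ℝ} (hw : ∀ i, 0 ≤ w i) (hw0 : w 0 = 1) {ξ c : ℝ}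
    (hξ : 0 < ξ) (hc : HasSum (fun k => w k * ξ ^ k) c) (hc1 : 1 < c)
    (hlam : ∀ T, 0 < T → (Summable fun k => w k * T ^ k) → c / ξ * T ≤ ∑' k, w k * T ^ k)
    {k : ℕ} (hk : 1 ≤ k) (σ : ℝ) {q ε : ℝ} (hq : q * (c - 1) = w k * ξ ^ k) (hε : 0 < ε) :
    ∃ θ > 0, Filter.Tendsto (fun n => (∑ P ∈ NCP n, OmegaP w P *
        Real.exp (θ * ∑ B ∈ P, blockScore k σ q ε B.card)) / Zw w n)
      (Filter.atTop ⊓ Filter.principal {n : ℕ | 0 < Zw w n}) (nhds 0) := by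
  obtain ⟨θ, hθ, c', hc', hlt, hle⟩ := exists_tilt hw hw0 hξ hc hc1 hk σ hq hε
  refine ⟨θ, hθ, ?_⟩
  obtain ⟨μ, hμ1, hμ2⟩ := exists_between (div_lt_div_of_pos_right hlt hξ)
  have hμ : 0 < μ := lt_trans (by positivity) hμ1
  obtain ⟨p, hp, hpμ⟩ := exists_pow_le_Zw hw hw0 hlam hμ hμ2
  obtain ⟨C, hC, hCle⟩ := exists_mul_pow_le_Zw hw hw0 hμ hp hpμ
  have hlim : Filter.Tendsto (fun n : ℕ => c' / C * (c' / ξ / μ) ^ n) Filter.atTop (nhds 0) := by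
    simpa using (tendsto_pow_atTop_nhds_zero_of_lt_one (r := c' / ξ / μ) (by positivity)
      ((div_lt_one hμ).2 hμ1)).const_mul (c' / C)
  refine squeeze_zero' (Filter.Eventually.of_forall fun n => div_nonneg
    (Finset.sum_nonneg fun P _ => mul_nonneg (OmegaP_nonneg hw P) (Real.exp_pos _).le)
    (Zw_nonneg hw n)) ?_ (hlim.mono_left inf_le_left)
  filter_upwards [Filter.mem_inf_of_right (Filter.mem_principal_self _)] with n hn
  calc _ ≤ c' * (c' / ξ) ^ n / (C * μ ^ n) :=
        div_le_div₀ (by positivity) (hle n) (by positivity) (hCle n hn)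
    _ = c' / C * (c' / ξ / μ) ^ n := by
        rw [div_pow (c' / ξ) μ]
        field_simp

lemma abs_ratio_sub_le {N z q ε θ₁ θ₂ : ℝ} (hN : 0 ≤ N) (hNz : N ≤ z) (hq0 : 0 ≤ q)
    (hq1 : q ≤ 1) (hε : 0 < ε) (hθ₁ : 0 < θ₁) (hθ₂ : 0 < θ₂) :
    |N / z - q| ≤ ε + Real.exp (θ₁ * (1 * (N - q * z) - ε * z)) +
      Real.exp (θ₂ * (-1 * (N - q * z) - ε * z)) := by
  have hz : 0 ≤ z := hN.trans hNz
  have hX1 : N / z ≤ 1 := div_le_one_of_le₀ hNz hz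
  have hX0 : 0 ≤ N / z := by positivity
  have habs : |N / z - q| ≤ 1 := abs_le.2 ⟨by linarith, by linarith⟩
  have h1 := Real.exp_pos (θ₁ * (1 * (N - q * z) - ε * z))
  have h2 := Real.exp_pos (θ₂ * (-1 * (N - q * z) - ε * z))
  by_cases hle : |N / z - q| ≤ ε
  · linarith
  have hNX : N = N / z * z := by
    rcases hz.eq_or_lt with rfl | hz
    · simpa using le_antisymm hNz hN
    · field_simp
  rcases lt_abs.1 (not_le.1 hle) with h | h
  · have : 0 ≤ θ₁ * (1 * (N - q * z) - ε * z) := mul_nonneg hθ₁.le (by nlinarith)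
    linarith [Real.one_le_exp this]
  · have : 0 ≤ θ₂ * (-1 * (N - q * z) - ε * z) := mul_nonneg hθ₂.le (by nlinarith)
    linarith [Real.one_le_exp this]

/-- under `ℙ^w_n`, the size of a uniformly random block converges in
distribution to `π(·)/(1 − π(0))`. -/
theorem stmt14 (w : ℕ → ℝ) (hw0 : w 0 = 1) (hw : ∀ i : ℕ, 0 ≤ w i)
    (hw2 : ∃ k : ℕ, 2 ≤ k ∧ 0 < w k)
    (π : ℕ → ℝ) (hπ : PiSpec w π) (hπ0 : π 0 < 1)
    (k : ℕ) (hk : 1 ≤ k) :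
    Filter.Tendsto
      (fun n : ℕ =>
        ∑ P ∈ NCP n, (OmegaP w P / Zw w n) *
          (((P.filter fun B => B.card = k).card : ℝ) / (P.card : ℝ)))
      (Filter.atTop ⊓ Filter.principal {n : ℕ | 0 < Zw w n})
      (nhds (π k / (1 - π 0))) := by
  rcases hπ with ⟨-, h0, -⟩ | ⟨-, ξ, hξ, -, hsM, hπk, hcase⟩
  · exact absurd h0 hπ0.ne
  have hsc : Summable fun k => w k * ξ ^ k := by
    rw [← summable_nat_add_iff 1]
    refine Summable.of_nonneg_of_le (fun j => mul_nonneg (hw _) (by positivity)) (fun j => ?_)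
      ((summable_nat_add_iff 1).2 hsM)
    rw [mul_assoc]
    refine le_mul_of_one_le_left (mul_nonneg (hw _) (by positivity)) ?_
    push_cast
    linarith [Nat.cast_nonneg (α := ℝ) j]
  have hterm : ∀ j, 0 ≤ w j * ξ ^ j := fun j => mul_nonneg (hw j) (by positivity)
  have hlam := fun T => div_mul_le_tsum hw hξ hsc.hasSum hsM.hasSum hcase (T := T)
  have hc := hsc.hasSum
  set c := ∑' j, w j * ξ ^ j
  have hcpos : 0 < c := hsc.tsum_pos hterm 0 (by simp [hw0])
  have hc1 : 1 < c := by
    rw [hπk 0, hw0, pow_zero, one_mul, div_lt_one hcpos] at hπ0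
    exact hπ0
  have hc1' : 0 < c - 1 := by linarith
  have hqeq : π k / (1 - π 0) = w k * ξ ^ k / (c - 1) := by
    rw [hπk k, hπk 0, hw0]
    field_simp
  rw [hqeq]
  set q := w k * ξ ^ k / (c - 1)
  have hq : q * (c - 1) = w k * ξ ^ k := div_mul_cancel₀ _ hc1'.ne'
  have hq0 : 0 ≤ q := div_nonneg (hterm k) hc1'.le
  have hq1 : q ≤ 1 := by
    refine (div_le_one hc1').2 ?_
    have h := hsc.sum_le_tsum {0, k} fun j _ => hterm j
    rw [Finset.sum_pair (by omega), hw0, pow_zero] at h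
    linarith
  rw [Metric.tendsto_nhds]
  intro δ hδ
  obtain ⟨θ₁, hθ₁, ht₁⟩ :=
    exists_tilt_tendsto hw hw0 hξ hc hc1 hlam hk 1 hq (half_pos hδ)
  obtain ⟨θ₂, hθ₂, ht₂⟩ :=
    exists_tilt_tendsto hw hw0 hξ hc hc1 hlam hk (-1) hq (half_pos hδ)
  filter_upwards [ht₁.eventually (gt_mem_nhds (show (0 : ℝ) < δ / 4 by positivity)),
    ht₂.eventually (gt_mem_nhds (show (0 : ℝ) < δ / 4 by positivity)),
    Filter.mem_inf_of_right (Filter.mem_principal_self _)] with n h₁ h₂ hn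
  have hn : 0 < Zw w n := hn
  have hone : ∑ P ∈ NCP n, OmegaP w P / Zw w n = 1 := by
    rw [← Finset.sum_div]
    exact div_self hn.ne'
  rw [Real.dist_eq]
  calc |∑ P ∈ NCP n, (OmegaP w P / Zw w n) *
          (((P.filter fun B => B.card = k).card : ℝ) / (P.card : ℝ)) - q|
      = |∑ P ∈ NCP n, (OmegaP w P / Zw w n) *
          (((P.filter fun B => B.card = k).card : ℝ) / (P.card : ℝ) - q)| := by
        simp only [mul_sub, Finset.sum_sub_distrib]
        rw [← Finset.sum_mul, hone, one_mul]
    _ ≤ ∑ P ∈ NCP n, (OmegaP w P / Zw w n) *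
          |((P.filter fun B => B.card = k).card : ℝ) / (P.card : ℝ) - q| := by
        refine (Finset.abs_sum_le_sum_abs _ _).trans (Finset.sum_le_sum fun P _ => ?_)
        rw [abs_mul, abs_of_nonneg (div_nonneg (OmegaP_nonneg hw P) hn.le)]
    _ ≤ ∑ P ∈ NCP n, (OmegaP w P / Zw w n) * (δ / 2 +
          Real.exp (θ₁ * ∑ B ∈ P, blockScore k 1 q (δ / 2) B.card) +
          Real.exp (θ₂ * ∑ B ∈ P, blockScore k (-1) q (δ / 2) B.card)) := by
        refine Finset.sum_le_sum fun P hP =>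
          mul_le_mul_of_nonneg_left ?_ (div_nonneg (OmegaP_nonneg hw P) hn.le)
        rw [sum_blockScore hP, sum_blockScore hP]
        exact abs_ratio_sub_le (Nat.cast_nonneg _)
          (Nat.cast_le.2 (Finset.card_filter_le _ _)) hq0 hq1 (half_pos hδ) hθ₁ hθ₂
    _ = δ / 2 + (∑ P ∈ NCP n, OmegaP w P *
            Real.exp (θ₁ * ∑ B ∈ P, blockScore k 1 q (δ / 2) B.card)) / Zw w n +
          (∑ P ∈ NCP n, OmegaP w P *
            Real.exp (θ₂ * ∑ B ∈ P, blockScore k (-1) q (δ / 2) B.card)) / Zw w n := by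
        simp only [mul_add, Finset.sum_add_distrib]
        rw [← Finset.sum_mul, hone, one_mul, Finset.sum_div, Finset.sum_div]
        simp only [div_mul_eq_mul_div]
    _ < δ := by linarith
end

section
/- For every nonempty set A ⊆ ℕ = {1,2,…} with A ≠ {1}, there exists a unique real number ξ > 0 such that the series Σ_{i∈A} i·ξ^i converges and 1 + Σ_{i∈A} ξ^i = Σ_{i∈A} i·ξ^i. -/
/-- Subtracting the two series turns the equation into `Σ_{i∈A} (i - 1)·ξ^i = 1`. -/
theorem one_add_tsum_pow_eq_iff_hasSum {A : Set ℕ} (hApos : ∀ a ∈ A, 1 ≤ a) {ξ : ℝ} (hξ : 0 ≤ ξ)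
    (hs : Summable fun i : A => (i : ℝ) * ξ ^ (i : ℕ)) :
    1 + ∑' i : A, ξ ^ (i : ℕ) = ∑' i : A, (i : ℝ) * ξ ^ (i : ℕ) ↔
      HasSum (fun i : A => ((i : ℝ) - 1) * ξ ^ (i : ℕ)) 1 := by
  have hp : Summable fun i : A => ξ ^ (i : ℕ) := by
    refine Summable.of_nonneg_of_le (fun i => by positivity) (fun i => ?_) hs
    have : (1 : ℝ) ≤ i := by exact_mod_cast hApos i i.2
    exact le_mul_of_one_le_left (by positivity) this
  have h : HasSum (fun i : A => ((i : ℝ) - 1) * ξ ^ (i : ℕ))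
      (∑' i : A, (i : ℝ) * ξ ^ (i : ℕ) - ∑' i : A, ξ ^ (i : ℕ)) := by
    simpa only [sub_mul, one_mul] using hs.hasSum.sub hp.hasSum
  constructor
  · intro he
    rwa [← he, add_sub_cancel_right] at h
  · intro h1
    linarith [h.unique h1]

/-- The sum `Σ_{i∈A} (i - 1)·ξ^i` is strictly increasing in `ξ ≥ 0`. -/
theorem lt_of_hasSum_sub_one_mul_pow {A : Set ℕ} (hApos : ∀ a ∈ A, 1 ≤ a) {m : ℕ} (hm : m ∈ A)
    (hm2 : 2 ≤ m) {x y a b : ℝ} (hx : 0 ≤ x) (hxy : x < y)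
    (ha : HasSum (fun i : A => ((i : ℝ) - 1) * x ^ (i : ℕ)) a)
    (hb : HasSum (fun i : A => ((i : ℝ) - 1) * y ^ (i : ℕ)) b) : a < b := by
  refine hasSum_lt (i := ⟨m, hm⟩) (fun i => ?_) ?_ ha hb
  · have : (1 : ℝ) ≤ i := by exact_mod_cast hApos i i.2
    exact mul_le_mul_of_nonneg_left (pow_le_pow_left₀ hx hxy.le _) (by linarith)
  · have : (2 : ℝ) ≤ m := by exact_mod_cast hm2
    exact mul_lt_mul_of_pos_left (pow_lt_pow_left₀ hxy hx (show m ≠ 0 by omega))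
      (by simp; linarith)

theorem summable_subtype_mul_pow (A : Set ℕ) {r : ℝ} (h0 : 0 ≤ r) (h1 : r < 1) :
    Summable fun i : A => (i : ℝ) * r ^ (i : ℕ) := by
  have h := summable_pow_mul_geometric_of_norm_lt_one (R := ℝ) 1
    (r := r) (by rwa [Real.norm_of_nonneg h0])
  simp only [pow_one] at h
  exact h.subtype A

/-- If `A` has an element `m ≥ 3`, the intermediate value theorem gives a solution below `1`. -/
theorem exists_hasSum_of_three_le {A : Set ℕ} (hApos : ∀ a ∈ A, 1 ≤ a) {m : ℕ} (hm : m ∈ A)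
    (hm3 : 3 ≤ m) :
    ∃ ξ : ℝ, 0 < ξ ∧ ξ < 1 ∧ HasSum (fun i : A => ((i : ℝ) - 1) * ξ ^ (i : ℕ)) 1 := by
  have hm3' : (3 : ℝ) ≤ m := by exact_mod_cast hm3
  have hA (i : A) : (1 : ℝ) ≤ i := by exact_mod_cast hApos i i.2
  obtain ⟨r, hr, hr0, hr1⟩ : ∃ r : ℝ, 1 < ((m : ℝ) - 1) * r ^ m ∧ 0 < r ∧ r < 1 := by
    have hc : Continuous fun r : ℝ => ((m : ℝ) - 1) * r ^ m := by fun_prop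
    have h1 : ∀ᶠ r in nhdsWithin (1 : ℝ) (Set.Iio 1), 1 < ((m : ℝ) - 1) * r ^ m :=
      nhdsWithin_le_nhds (hc.continuousAt.eventually_const_lt (by simp; linarith))
    exact (h1.and (Ioo_mem_nhdsLT one_pos)).exists
  have hbound (i : A) (x : ℝ) (hx : x ∈ Set.Icc 0 r) :
      ‖((i : ℝ) - 1) * x ^ (i : ℕ)‖ ≤ (i : ℝ) * r ^ (i : ℕ) := by
    have := hA i
    have h0 := hx.1
    rw [Real.norm_of_nonneg (mul_nonneg (by linarith) (by positivity))]
    exact mul_le_mul (by linarith) (pow_le_pow_left₀ h0 hx.2 _) (by positivity) (by linarith)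
  have hs := summable_subtype_mul_pow A hr0.le hr1
  have hsum (x : ℝ) (hx : x ∈ Set.Icc 0 r) :
      Summable fun i : A => ((i : ℝ) - 1) * x ^ (i : ℕ) :=
    hs.of_norm_bounded fun i => hbound i x hx
  have hcont : ContinuousOn (fun x : ℝ => ∑' i : A, ((i : ℝ) - 1) * x ^ (i : ℕ))
      (Set.Icc 0 r) :=
    continuousOn_tsum (fun i => by fun_prop) hs hbound
  have hzero : ∑' i : A, ((i : ℝ) - 1) * (0 : ℝ) ^ (i : ℕ) = 0 := by
    refine (tsum_congr fun i => ?_).trans tsum_zero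
    rw [zero_pow (by have := hApos i i.2; omega), mul_zero]
  have hle : 1 ≤ ∑' i : A, ((i : ℝ) - 1) * r ^ (i : ℕ) := by
    refine hr.le.trans ((hsum r ⟨hr0.le, le_rfl⟩).le_tsum (⟨m, hm⟩ : A) fun i _ => ?_)
    exact mul_nonneg (by linarith [hA i]) (by positivity)
  obtain ⟨ξ, hξ, he⟩ := intermediate_value_Icc hr0.le hcont
    (show (1 : ℝ) ∈ Set.Icc _ _ from ⟨by simp only [hzero, zero_le_one], hle⟩)
  refine ⟨ξ, lt_of_le_of_ne hξ.1 ?_, hξ.2.trans_lt hr1, ?_⟩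
  · rintro rfl
    exact one_ne_zero (he.symm.trans hzero)
  · have h := (hsum ξ hξ).hasSum
    rwa [show ∑' i : A, ((i : ℝ) - 1) * ξ ^ (i : ℕ) = 1 from he] at h

/-- for every nonempty `A ⊆ ℕ = {1, 2, …}` with `A ≠ {1}` there is a
unique `ξ > 0` such that `Σ_{i∈A} i·ξ^i` converges and
`1 + Σ_{i∈A} ξ^i = Σ_{i∈A} i·ξ^i`. -/
theorem stmt17 (A : Set ℕ) (hA : A.Nonempty) (hApos : ∀ a ∈ A, 1 ≤ a) (hA1 : A ≠ {1}) :
    ∃! ξ : ℝ, 0 < ξ ∧ (Summable fun i : A => (i : ℝ) * ξ ^ (i : ℕ)) ∧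
      1 + ∑' i : A, ξ ^ (i : ℕ) = ∑' i : A, (i : ℝ) * ξ ^ (i : ℕ) := by
  obtain ⟨m, hm, hm2⟩ : ∃ m ∈ A, 2 ≤ m := by
    by_contra! h
    exact hA1 (hA.subset_singleton_iff.1 fun a ha => by
      have := h a ha
      have := hApos a ha
      simp only [Set.mem_singleton_iff]
      omega)
  refine existsUnique_of_exists_of_unique ?_ ?_
  · by_cases h3 : ∃ k ∈ A, 3 ≤ k
    · obtain ⟨k, hk, hk3⟩ := h3
      obtain ⟨ξ, h0, h1, h⟩ := exists_hasSum_of_three_le hApos hk hk3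
      have hs := summable_subtype_mul_pow A h0.le h1
      exact ⟨ξ, h0, hs, (one_add_tsum_pow_eq_iff_hasSum hApos h0.le hs).2 h⟩
    · push Not at h3
      obtain rfl : m = 2 := by have := h3 m hm; omega
      have : Finite A := ((Set.finite_Iio 3).subset fun a ha => h3 a ha).to_subtype
      have hs : Summable fun i : A => (i : ℝ) * (1 : ℝ) ^ (i : ℕ) := Summable.of_finite
      refine ⟨1, one_pos, hs, (one_add_tsum_pow_eq_iff_hasSum hApos zero_le_one hs).2 ?_⟩
      have h := hasSum_single (f := fun i : A => ((i : ℝ) - 1) * (1 : ℝ) ^ (i : ℕ)) ⟨2, hm⟩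
        fun i hi => by
          have h2 : (i : ℕ) ≠ 2 := fun h => hi (Subtype.ext h)
          have : (i : ℕ) = 1 := by
            have := h3 i i.2
            have := hApos i i.2
            omega
          simp [this]
      norm_num at h
      simpa using h
  · rintro x y ⟨hx, hxs, hxe⟩ ⟨hy, hys, hye⟩
    rw [one_add_tsum_pow_eq_iff_hasSum hApos hx.le hxs] at hxe
    rw [one_add_tsum_pow_eq_iff_hasSum hApos hy.le hys] at hye
    rcases lt_trichotomy x y with h | h | h
    · exact absurd (lt_of_hasSum_sub_one_mul_pow hApos hm hm2 hx.le h hxe hye) (lt_irrefl _)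
    · exact h
    · exact absurd (lt_of_hasSum_sub_one_mul_pow hApos hm hm2 hy.le h hye hxe) (lt_irrefl _)
end
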